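/- lim_{s → ∞} sup_{x ∈ Ω} ∫₀^T e^{2s(α(x,t) − α(x,t₀))} dt = 0, where t₀ := T/2. More precisely, for every x ∈ Ω and t ∈ (0,T), α(x,t₀) − α(x,t) ≥ C₀ (1/μ(t) − 1/μ(t₀)) with C₀ := e^{2λη̄} − e^{λη̄} > 0, so sup_{x ∈ Ω} ∫₀^T e^{2s(α(x,t) − α(x,t₀))} dt ≤ ∫₀^T exp( −2sC₀ ( 1/μ(t) − 1/μ(t₀) ) ) dt, and the latter integral tends to 0 as s → ∞ by the dominated convergence theorem. -/

import Mathlib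

open MeasureTheory Real Set Filter
open scoped RealInnerProductSpace

noncomputable section

/-- `ℝ^d` as a Euclidean space. -/
abbrev Euc (d : ℕ) := EuclideanSpace ℝ (Fin d)

/-- Partial derivative `∂ᵢ f` of a scalar function on `ℝ^d`. -/
noncomputable def pderiv' {d : ℕ} (i : Fin d) (f : Euc d → ℝ) (x : Euc d) : ℝ :=
  fderiv ℝ f x (EuclideanSpace.single i 1)

/-- Laplacian `Δ f = ∑ᵢ ∂ᵢ∂ᵢ f`. -/
noncomputable def lapl {d : ℕ} (f : Euc d → ℝ) (x : Euc d) : ℝ :=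
  ∑ i, pderiv' i (pderiv' i f) x

/-- Divergence `div G = ∑ᵢ ∂ᵢ Gᵢ` of a vector field on `ℝ^d`. -/
noncomputable def divg {d : ℕ} (G : Euc d → Euc d) (x : Euc d) : ℝ :=
  ∑ i, pderiv' i (fun y => G y i) x

/-- The Carleman weight `φ(x,t) = e^{λη(x)} / (t(T−t))`. -/
noncomputable def wphi {d : ℕ} (lam T : ℝ) (η : Euc d → ℝ) (x : Euc d) (t : ℝ) : ℝ :=
  Real.exp (lam * η x) / (t * (T - t))

/-- The Carleman weight `α(x,t) = (e^{λη(x)} − e^{2λη̄}) / (t(T−t))`. -/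
noncomputable def walp {d : ℕ} (lam T ηb : ℝ) (η : Euc d → ℝ) (x : Euc d) (t : ℝ) : ℝ :=
  (Real.exp (lam * η x) - Real.exp (2 * lam * ηb)) / (t * (T - t))

/-- sup_{x ∈ Ω} ∫₀ᵀ e^{2s(α(x,t) − α(x,t₀))} dt → 0 as s → ∞, via the pointwise
bound α(x,t₀) − α(x,t) ≥ C₀(1/μ(t) − 1/μ(t₀)) and dominated convergence. -/
theorem stmt_17
    (d : ℕ) (Ω : Set (Euc d)) (hΩne : Ω.Nonempty) (T : ℝ) (hT : 0 < T)
    (lam ηb : ℝ) (hlam : 0 < lam) (hηb : 0 < ηb)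
    (η : Euc d → ℝ) (hη : ∀ x ∈ Ω, 0 ≤ η x ∧ η x ≤ ηb) :
    (∀ x ∈ Ω, ∀ t ∈ Ioo (0:ℝ) T,
      (Real.exp (2 * lam * ηb) - Real.exp (lam * ηb))
          * (1 / (t * (T - t)) - 1 / ((T/2) * (T - T/2)))
        ≤ walp lam T ηb η x (T/2) - walp lam T ηb η x t) ∧
    (∀ s : ℝ, 0 ≤ s →
      (⨆ x ∈ Ω, ∫ t in Ioo (0:ℝ) T,
          Real.exp (2 * s * (walp lam T ηb η x t - walp lam T ηb η x (T/2))))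
        ≤ ∫ t in Ioo (0:ℝ) T,
            Real.exp (-2 * s * (Real.exp (2 * lam * ηb) - Real.exp (lam * ηb))
              * (1 / (t * (T - t)) - 1 / ((T/2) * (T - T/2))))) ∧
    Tendsto (fun s : ℝ => ∫ t in Ioo (0:ℝ) T,
        Real.exp (-2 * s * (Real.exp (2 * lam * ηb) - Real.exp (lam * ηb))
          * (1 / (t * (T - t)) - 1 / ((T/2) * (T - T/2))))) atTop (nhds 0) ∧
    Tendsto (fun s : ℝ => ⨆ x ∈ Ω, ∫ t in Ioo (0:ℝ) T,
        Real.exp (2 * s * (walp lam T ηb η x t - walp lam T ηb η x (T/2))))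
      atTop (nhds 0) := by
  have hC : 0 < Real.exp (2 * lam * ηb) - Real.exp (lam * ηb) := by
    have : lam * ηb < 2 * lam * ηb := by nlinarith [mul_pos hlam hηb]
    linarith [Real.exp_lt_exp.mpr this]
  have hg : ∀ t ∈ Ioo (0:ℝ) T, 0 ≤ 1 / (t * (T - t)) - 1 / ((T/2) * (T - T/2)) := by
    intro t ht
    have h1 : 0 < t * (T - t) := mul_pos ht.1 (by linarith [ht.2])
    have h2 : t * (T - t) ≤ (T/2) * (T - T/2) := by nlinarith [sq_nonneg (t - T/2)]
    linarith [one_div_le_one_div_of_le h1 h2]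
  have hg' : ∀ t ∈ Ioo (0:ℝ) T, t ≠ T/2 →
      0 < 1 / (t * (T - t)) - 1 / ((T/2) * (T - T/2)) := by
    intro t ht hne
    have h1 : 0 < t * (T - t) := mul_pos ht.1 (by linarith [ht.2])
    have h3 : 0 < (t - T/2)^2 := by
      have := sub_ne_zero.mpr hne
      positivity
    have h2 : t * (T - t) < (T/2) * (T - T/2) := by nlinarith
    linarith [one_div_lt_one_div_of_lt h1 h2]
  have hA : ∀ x ∈ Ω, ∀ t ∈ Ioo (0:ℝ) T,
      (Real.exp (2 * lam * ηb) - Real.exp (lam * ηb))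
          * (1 / (t * (T - t)) - 1 / ((T/2) * (T - T/2)))
        ≤ walp lam T ηb η x (T/2) - walp lam T ηb η x t := by
    intro x hx t ht
    have he : Real.exp (lam * η x) ≤ Real.exp (lam * ηb) :=
      Real.exp_le_exp.mpr (mul_le_mul_of_nonneg_left (hη x hx).2 hlam.le)
    have e : walp lam T ηb η x (T/2) - walp lam T ηb η x t =
        (Real.exp (2 * lam * ηb) - Real.exp (lam * η x))
          * (1 / (t * (T - t)) - 1 / ((T/2) * (T - T/2))) := by
      unfold walp
      ring
    rw [e]
    exact mul_le_mul_of_nonneg_right (by linarith) (hg t ht)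
  have hle1 : ∀ s : ℝ, 0 ≤ s → ∀ t ∈ Ioo (0:ℝ) T,
      Real.exp (-2 * s * (Real.exp (2 * lam * ηb) - Real.exp (lam * ηb))
        * (1 / (t * (T - t)) - 1 / ((T/2) * (T - T/2)))) ≤ 1 := by
    intro s hs t ht
    rw [Real.exp_le_one_iff]
    have := mul_nonneg (mul_nonneg hs hC.le) (hg t ht)
    linarith
  have hmeas : ∀ s : ℝ, Measurable (fun t : ℝ =>
      Real.exp (-2 * s * (Real.exp (2 * lam * ηb) - Real.exp (lam * ηb))
        * (1 / (t * (T - t)) - 1 / ((T/2) * (T - T/2))))) := by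
    intro s
    fun_prop
  have hone : Integrable (fun _ : ℝ => (1:ℝ)) (volume.restrict (Ioo (0:ℝ) T)) :=
    integrable_const _
  have hB : ∀ s : ℝ, 0 ≤ s →
      (⨆ x ∈ Ω, ∫ t in Ioo (0:ℝ) T,
          Real.exp (2 * s * (walp lam T ηb η x t - walp lam T ηb η x (T/2))))
        ≤ ∫ t in Ioo (0:ℝ) T,
            Real.exp (-2 * s * (Real.exp (2 * lam * ηb) - Real.exp (lam * ηb))
              * (1 / (t * (T - t)) - 1 / ((T/2) * (T - T/2)))) := by
    intro s hs
    have h0 : 0 ≤ ∫ t in Ioo (0:ℝ) T,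
            Real.exp (-2 * s * (Real.exp (2 * lam * ηb) - Real.exp (lam * ηb))
              * (1 / (t * (T - t)) - 1 / ((T/2) * (T - T/2)))) :=
      integral_nonneg fun t => (Real.exp_pos _).le
    refine Real.iSup_le (fun x => Real.iSup_le (fun hx => ?_) h0) h0
    refine integral_mono_of_nonneg (ae_of_all _ fun t => (Real.exp_pos _).le) ?_ ?_
    · refine hone.mono' (hmeas s).aestronglyMeasurable ?_
      filter_upwards [ae_restrict_mem measurableSet_Ioo] with t ht
      rw [Real.norm_eq_abs, abs_of_pos (Real.exp_pos _)]
      exact hle1 s hs t ht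
    · filter_upwards [ae_restrict_mem measurableSet_Ioo] with t ht
      refine Real.exp_le_exp.mpr ?_
      have := mul_le_mul_of_nonneg_left (hA x hx t ht) hs
      linarith
  have hL : Tendsto (fun s : ℝ => ∫ t in Ioo (0:ℝ) T,
        Real.exp (-2 * s * (Real.exp (2 * lam * ηb) - Real.exp (lam * ηb))
          * (1 / (t * (T - t)) - 1 / ((T/2) * (T - T/2))))) atTop (nhds 0) := by
    have key := tendsto_integral_filter_of_dominated_convergence
      (μ := volume.restrict (Ioo (0:ℝ) T)) (l := (atTop : Filter ℝ))
      (F := fun s t => Real.exp (-2 * s * (Real.exp (2 * lam * ηb) - Real.exp (lam * ηb))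
          * (1 / (t * (T - t)) - 1 / ((T/2) * (T - T/2)))))
      (f := fun _ => (0:ℝ)) (fun _ => (1:ℝ))
      (Eventually.of_forall fun s => (hmeas s).aestronglyMeasurable) ?_ hone ?_
    · simpa only [integral_zero] using key
    · filter_upwards [eventually_ge_atTop (0:ℝ)] with s hs
      filter_upwards [ae_restrict_mem measurableSet_Ioo] with t ht
      rw [Real.norm_eq_abs, abs_of_pos (Real.exp_pos _)]
      exact hle1 s hs t ht
    · have hne : ∀ᵐ t ∂(volume.restrict (Ioo (0:ℝ) T)), t ≠ T/2 :=
        ae_restrict_of_ae (Measure.ae_ne volume (T/2))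
      filter_upwards [ae_restrict_mem measurableSet_Ioo, hne] with t ht hne
      have hp := mul_pos (mul_pos two_pos hC) (hg' t ht hne)
      have h1 := tendsto_neg_atTop_atBot.comp (tendsto_id.atTop_mul_const hp)
      refine (Real.tendsto_exp_atBot.comp h1).congr fun s => ?_
      simp only [Function.comp, id]
      congr 1
      ring
  refine ⟨hA, hB, hL, ?_⟩
  refine tendsto_of_tendsto_of_tendsto_of_le_of_le' tendsto_const_nhds hL ?_ ?_
  · exact Eventually.of_forall fun s => Real.iSup_nonneg fun x => Real.iSup_nonneg fun _ =>
      integral_nonneg fun t => (Real.exp_pos _).le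
  · filter_upwards [eventually_ge_atTop (0:ℝ)] with s hs
    exact hB s hs
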